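/- Let ν ≥ 1 and for x > e define the thresholding selector η̂_ν(x) with components η̂_{ν,i}(x) = 1( X_i ≥ σ(ν log x + ν log log x)^{1/ν} ), i = 1,…,d. (i) If the sequences (s_d, a_d)_{d≥1} satisfy d − s_d → ∞ and a_d ≥ σ( (ν log(d−s_d) + ν log log(d−s_d))^{1/ν} + (ν log s_d + ν log log(d−s_d))^{1/ν} ) for all d large enough, then the selector η̂ = η̂_ν(d − s_d) achieves exact recovery: limsup_{d→∞} sup_{F ∈ 𝒫_ν} sup_{μ ∈ Θ_d(s_d,a_d)} E_{μ,F}|η̂ − η(μ)| = 0, and consequently limsup_{d→∞} sup_{F ∈ 𝒫_ν} sup_{μ ∈ Θ_d(s_d,a_d)} P_{μ,F}(S_{η̂} ≠ S_{η(μ)}) = 0. (ii) If d/s_d → ∞ and a_d ≥ σ( (ν log(d/s_d − 1) + ν log log(d/s_d − 1))^{1/ν} + (ν log log(d/s_d − 1))^{1/ν} ) for all d large enough, then the selector η̂ = η̂_ν(d/s_d − 1) achieves almost full recovery: limsup_{d→∞} sup_{F ∈ 𝒫_ν} sup_{μ ∈ Θ_d(s_d,a_d)} (1/s_d) E_{μ,F}|η̂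 − η(μ)| = 0. -/

import Mathlib

open MeasureTheory Finset Filter
open scoped ENNReal Classical

noncomputable section

/-- Hamming distance between two binary vectors. -/
def hamming {d : ℕ} (a b : Fin d → Bool) : ℕ := (univ.filter fun j => a j ≠ b j).card

/-- The sparsity class `Θ_d(s,a)` of mean vectors. -/
def ThetaLoc (d s : ℕ) (a : ℝ) : Set (Fin d → ℝ) :=
  {μ | ∃ S : Finset (Fin d), S.card = s ∧ (∀ j ∈ S, a ≤ μ j) ∧ ∀ j ∉ S, μ j = 0}

/-- The binary vector `η(μ)` of nonzero positions of `μ`. -/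
def etaOf {d : ℕ} (μ : Fin d → ℝ) : Fin d → Bool := fun j => decide (μ j ≠ 0)

/-- The law `P_{μ,F}` of the observations `X_i = μ_i + σ ξ_i` with i.i.d. noise of law `Q`. -/
def Ploc (σ : ℝ) (Q : Measure ℝ) {d : ℕ} (μ : Fin d → ℝ) : Measure (Fin d → ℝ) :=
  Measure.pi fun i => Q.map fun x => μ i + σ * x

/-- The class `𝒫_ν` of noise distributions (identified with their laws): probability measures
`Q` on `ℝ` whose c.d.f. `F` satisfies `1 − F(u) ≤ e^{−u^ν/ν}` and `F(−u) ≤ e^{−u^ν/ν}` for all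
`u ≥ 0`. -/
def Pclass (ν : ℝ) : Set (Measure ℝ) :=
  {Q | IsProbabilityMeasure Q ∧ ∀ u : ℝ, 0 ≤ u →
      (Q (Set.Ioi u)).toReal ≤ Real.exp (-(u ^ ν) / ν) ∧
      (Q (Set.Iic (-u))).toReal ≤ Real.exp (-(u ^ ν) / ν)}

/-- Expected Hamming risk of a nonrandomized selector in the location model. -/
def detRiskLoc (σ : ℝ) (Q : Measure ℝ) {d : ℕ}
    (sel : (Fin d → ℝ) → Fin d → Bool) (μ : Fin d → ℝ) : ℝ :=
  ∫ X, (hamming (sel X) (etaOf μ) : ℝ) ∂(Ploc σ Q μ)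

/-- The set of maximal (over `F ∈ 𝒫_ν` and `μ ∈ Θ_d(s,a)`) expected Hamming risks of all
(randomized, measurable) selectors in the location model. -/
def HamRiskSetLoc (ν σ : ℝ) (d s : ℕ) (a : ℝ) : Set ℝ :=
  { r | ∃ (Z : Type) (_ : MeasurableSpace Z) (ζ : Measure Z),
      IsProbabilityMeasure ζ ∧
      ∃ sel : (Fin d → ℝ) → Z → Fin d → Bool,
        Measurable (Function.uncurry sel) ∧
        r = ⨆ Q : Pclass ν, ⨆ μ : ThetaLoc d s a,
              ∫ z, ∫ X, (hamming (sel X z) (etaOf μ.1) : ℝ) ∂(Ploc σ Q.1 μ.1) ∂ζ }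

/-- The set of maximal (over `F ∈ 𝒫_ν` and `μ ∈ Θ_d(s,a)`) probabilities of wrong recovery of
all (randomized, measurable) selectors in the location model. -/
def WrongRiskSetLoc (ν σ : ℝ) (d s : ℕ) (a : ℝ) : Set ℝ :=
  { r | ∃ (Z : Type) (_ : MeasurableSpace Z) (ζ : Measure Z),
      IsProbabilityMeasure ζ ∧
      ∃ sel : (Fin d → ℝ) → Z → Fin d → Bool,
        Measurable (Function.uncurry sel) ∧
        r = ⨆ Q : Pclass ν, ⨆ μ : ThetaLoc d s a,
              ∫ z, ((Ploc σ Q.1 μ.1) {X | sel X z ≠ etaOf μ.1}).toReal ∂ζ }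


/-- The thresholding selector `η̂_ν(x)`: its `i`-th component is the indicator of
`X_i ≥ σ(ν log x + ν log log x)^{1/ν}`. -/
def threshLoc (σ ν x : ℝ) {d : ℕ} (X : Fin d → ℝ) : Fin d → Bool := fun i =>
  decide (σ * (ν * Real.log x + ν * Real.log (Real.log x)) ^ (1 / ν) ≤ X i)

/-- At a nonnegative point the closed upper tail also satisfies the bound defining `Pclass`. -/
lemma Pclass.measureReal_Ici_le {ν : ℝ} {Q : Measure ℝ} (hQ : Q ∈ Pclass ν)
    {u : ℝ} (hu : 0 < u) : Q.real (Set.Ici u) ≤ Real.exp (-(u ^ ν) / ν) := by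
  obtain ⟨hprob, htail⟩ := hQ
  have hcont : ContinuousAt (fun v : ℝ => Real.exp (-(v ^ ν) / ν)) u :=
    (((Real.continuousAt_rpow_const u ν (Or.inl hu.ne')).neg).div_const ν).rexp
  have hlim : Tendsto (fun v : ℝ => Real.exp (-(v ^ ν) / ν)) (nhdsWithin u (Set.Iio u))
      (nhds (Real.exp (-(u ^ ν) / ν))) := hcont.tendsto.mono_left nhdsWithin_le_nhds
  refine ge_of_tendsto hlim ?_
  filter_upwards [Ioo_mem_nhdsLT hu] with v hv
  exact (measureReal_mono (Set.Ici_subset_Ioi.2 hv.2)).trans (htail v hv.1.le).1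

/-- The number of differing coordinates as a sum of indicators. -/
lemma hamming_eq_sum {d : ℕ} (a b : Fin d → Bool) :
    (hamming a b : ℝ) = ∑ j, if a j ≠ b j then (1 : ℝ) else 0 := by
  simp only [hamming, Finset.card_filter]
  push_cast
  rfl

lemma isProbabilityMeasure_map_location {σ : ℝ} {Q : Measure ℝ} [IsProbabilityMeasure Q] (m : ℝ) :
    IsProbabilityMeasure (Q.map fun x => m + σ * x) :=
  Measure.isProbabilityMeasure_map (by fun_prop)

lemma isProbabilityMeasure_Ploc (σ : ℝ) {Q : Measure ℝ} [IsProbabilityMeasure Q] {d : ℕ}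
    (μ : Fin d → ℝ) : IsProbabilityMeasure (Ploc σ Q μ) := by
  have := fun i => isProbabilityMeasure_map_location (σ := σ) (Q := Q) (μ i)
  unfold Ploc
  infer_instance

/-- Each coordinate of the observation has the law of `μ j + σ ξ`. -/
lemma Ploc_real_coord (σ : ℝ) {Q : Measure ℝ} [IsProbabilityMeasure Q] {d : ℕ}
    (μ : Fin d → ℝ) (j : Fin d) {A : Set ℝ} (hA : MeasurableSet A) :
    (Ploc σ Q μ).real {X | X j ∈ A} = Q.real {x | μ j + σ * x ∈ A} := by
  have := fun i => isProbabilityMeasure_map_location (σ := σ) (Q := Q) (μ i)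
  have hpres := measurePreserving_eval (fun i => Q.map fun x => μ i + σ * x) j
  have h : (Ploc σ Q μ) (Function.eval j ⁻¹' A) = (Q.map fun x => μ j + σ * x) A :=
    hpres.measure_preimage hA.nullMeasurableSet
  rw [Measure.map_apply (by fun_prop) hA] at h
  exact congrArg ENNReal.toReal h

lemma measurableSet_threshLoc_ne (σ ν x : ℝ) {d : ℕ} (b : Fin d → Bool) (j : Fin d) :
    MeasurableSet {X : Fin d → ℝ | threshLoc σ ν x X j ≠ b j} := by
  have h : MeasurableSet {X : Fin d → ℝ |
      σ * (ν * Real.log x + ν * Real.log (Real.log x)) ^ (1 / ν) ≤ X j} :=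
    measurableSet_le measurable_const (measurable_pi_apply j)
  cases hb : b j
  · simpa [threshLoc] using h
  · simpa [threshLoc, Set.compl_ofPred] using h.compl

lemma integrable_threshLoc_ne (σ ν x : ℝ) {Q : Measure ℝ} [IsProbabilityMeasure Q] {d : ℕ}
    (μ : Fin d → ℝ) (b : Fin d → Bool) (j : Fin d) :
    Integrable (fun X => if threshLoc σ ν x X j ≠ b j then (1 : ℝ) else 0) (Ploc σ Q μ) := by
  have := isProbabilityMeasure_Ploc σ (Q := Q) μ
  refine ((integrable_const (μ := Ploc σ Q μ) (1 : ℝ)).indicator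
    (measurableSet_threshLoc_ne σ ν x b j)).congr (Eventually.of_forall fun X => ?_)
  simp only [Set.indicator_apply, Set.mem_ofPred_eq]

/-- The Hamming risk is the sum of the coordinatewise error probabilities. -/
lemma detRiskLoc_threshLoc (σ ν x : ℝ) {Q : Measure ℝ} [IsProbabilityMeasure Q] {d : ℕ}
    (μ : Fin d → ℝ) :
    detRiskLoc σ Q (threshLoc σ ν x) μ =
      ∑ j, (Ploc σ Q μ).real {X | threshLoc σ ν x X j ≠ etaOf μ j} := by
  simp only [detRiskLoc, hamming_eq_sum]
  rw [integral_finsetSum _ fun j _ => integrable_threshLoc_ne σ ν x μ _ j]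
  refine Finset.sum_congr rfl fun j _ => ?_
  have h := integral_indicator_one (μ := Ploc σ Q μ)
    (measurableSet_threshLoc_ne σ ν x (etaOf μ) j)
  simpa only [Set.indicator_apply, Set.mem_ofPred_eq, Pi.one_apply] using h

/-- The probability of wrong recovery is at most the Hamming risk. -/
lemma Ploc_threshLoc_ne_le_detRiskLoc (σ ν x : ℝ) {Q : Measure ℝ} [IsProbabilityMeasure Q]
    {d : ℕ} (μ : Fin d → ℝ) :
    ((Ploc σ Q μ) {X | threshLoc σ ν x X ≠ etaOf μ}).toReal ≤
      detRiskLoc σ Q (threshLoc σ ν x) μ := by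
  have := isProbabilityMeasure_Ploc σ (Q := Q) μ
  rw [detRiskLoc_threshLoc]
  refine le_trans (measureReal_mono (fun X hX => ?_)) (measureReal_iUnion_fintype_le _)
  simpa [Function.ne_iff] using hX

/-- Nonasymptotic bound on the Hamming risk of thresholding at `σ T`, when the signal exceeds the
threshold by at least `σ U`. -/
lemma detRiskLoc_threshLoc_le {ν σ x T U a : ℝ} (hσ : 0 < σ)
    (hT : T = (ν * Real.log x + ν * Real.log (Real.log x)) ^ (1 / ν))
    (hT_pos : 0 < T) (hU : 0 ≤ U) {d s : ℕ} (hsd : s ≤ d) (ha : σ * (T + U) ≤ a)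
    {Q : Measure ℝ} (hQ : Q ∈ Pclass ν) {μ : Fin d → ℝ} (hμ : μ ∈ ThetaLoc d s a) :
    detRiskLoc σ Q (threshLoc σ ν x) μ ≤
      ((d : ℝ) - s) * Real.exp (-(T ^ ν) / ν) + s * Real.exp (-(U ^ ν) / ν) := by
  have := hQ.1
  obtain ⟨S, hcard, hS, hSc⟩ := hμ
  have ha_pos : 0 < a := (by positivity : 0 < σ * (T + U)).trans_le ha
  rw [detRiskLoc_threshLoc, ← Finset.sum_compl_add_sum S]
  have hnull : ∀ j ∈ Sᶜ, (Ploc σ Q μ).real {X | threshLoc σ ν x X j ≠ etaOf μ j} ≤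
      Real.exp (-(T ^ ν) / ν) := by
    intro j hj
    have hj0 : μ j = 0 := hSc j (Finset.mem_compl.1 hj)
    have hset : {X : Fin d → ℝ | threshLoc σ ν x X j ≠ etaOf μ j} =
        {X | X j ∈ Set.Ici (σ * T)} := by
      ext X
      simp [threshLoc, etaOf, hj0, hT]
    rw [hset, Ploc_real_coord σ μ j measurableSet_Ici]
    have hpre : {y : ℝ | μ j + σ * y ∈ Set.Ici (σ * T)} = Set.Ici T := by
      ext y
      simp [hj0, hσ]
    rw [hpre]
    exact Pclass.measureReal_Ici_le hQ hT_pos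
  have hsignal : ∀ j ∈ S, (Ploc σ Q μ).real {X | threshLoc σ ν x X j ≠ etaOf μ j} ≤
      Real.exp (-(U ^ ν) / ν) := by
    intro j hj
    have hja : a ≤ μ j := hS j hj
    have hj0 : μ j ≠ 0 := (ha_pos.trans_le hja).ne'
    have hset : {X : Fin d → ℝ | threshLoc σ ν x X j ≠ etaOf μ j} =
        {X | X j ∈ Set.Iio (σ * T)} := by
      ext X
      simp [threshLoc, etaOf, hj0, hT]
    rw [hset, Ploc_real_coord σ μ j measurableSet_Iio]
    refine (measureReal_mono fun y hy => ?_).trans (hQ.2 U hU).2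
    have hy' : μ j + σ * y < σ * T := hy
    have : σ * y ≤ σ * (-U) := by linarith
    exact le_of_mul_le_mul_left this hσ
  refine (add_le_add (Finset.sum_le_card_nsmul _ _ _ hnull)
    (Finset.sum_le_card_nsmul _ _ _ hsignal)).trans_eq ?_
  simp [Finset.card_compl, hcard, Nat.cast_sub hsd]

lemma exp_neg_rpow_inv_div {ν w : ℝ} (hν : 1 ≤ ν) (hw : 0 ≤ w) :
    Real.exp (-((ν * w) ^ (1 / ν)) ^ ν / ν) = Real.exp (-w) := by
  have hν0 : 0 < ν := by linarith
  rw [← Real.rpow_mul (by positivity), one_div_mul_cancel hν0.ne', Real.rpow_one]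
  congr 1
  field_simp

/-- Risk bound for the threshold `threshLoc σ ν x` with the type II error budget governed by
`y`. -/
lemma detRiskLoc_threshLoc_le_div {ν σ x y a : ℝ} (hν : 1 ≤ ν) (hσ : 0 < σ)
    (hx : Real.exp 1 < x) (hy : 1 ≤ y) {d s : ℕ} (hsd : s ≤ d)
    (ha : σ * ((ν * Real.log x + ν * Real.log (Real.log x)) ^ (1 / ν)
      + (ν * Real.log y + ν * Real.log (Real.log x)) ^ (1 / ν)) ≤ a)
    {Q : Measure ℝ} (hQ : Q ∈ Pclass ν) {μ : Fin d → ℝ} (hμ : μ ∈ ThetaLoc d s a) :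
    detRiskLoc σ Q (threshLoc σ ν x) μ ≤
      ((d : ℝ) - s) / (x * Real.log x) + s / (y * Real.log x) := by
  have hx0 : 0 < x := (Real.exp_pos 1).trans hx
  have hlog : 1 < Real.log x := (Real.lt_log_iff_exp_lt hx0).2 hx
  have hloglog : 0 < Real.log (Real.log x) := Real.log_pos hlog
  have hlogy : 0 ≤ Real.log y := Real.log_nonneg hy
  refine (detRiskLoc_threshLoc_le hσ rfl (by positivity) (by positivity) hsd ha hQ hμ).trans_eq
    ?_
  rw [← mul_add, ← mul_add, exp_neg_rpow_inv_div hν (by positivity),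
    exp_neg_rpow_inv_div hν (by positivity),
    ← Real.log_mul (by positivity) (by positivity), ← Real.log_mul (by positivity) (by positivity),
    Real.exp_neg, Real.exp_neg, Real.exp_log (by positivity), Real.exp_log (by positivity)]
  simp only [div_eq_mul_inv]

/-- A real supremum over `Pclass` and `ThetaLoc` is bounded by any nonnegative uniform bound. -/
lemma iSup_Pclass_ThetaLoc_le {ν a B : ℝ} {d s : ℕ} {f : Measure ℝ → (Fin d → ℝ) → ℝ}
    (hB : 0 ≤ B) (hf : ∀ Q ∈ Pclass ν, ∀ μ ∈ ThetaLoc d s a, f Q μ ≤ B) :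
    ⨆ Q : Pclass ν, ⨆ μ : ThetaLoc d s a, f Q.1 μ.1 ≤ B :=
  Real.iSup_le (fun Q => Real.iSup_le (fun μ => hf Q.1 Q.2 μ.1 μ.2) hB) hB

lemma detRiskLoc_nonneg (σ : ℝ) (Q : Measure ℝ) {d : ℕ} (sel : (Fin d → ℝ) → Fin d → Bool)
    (μ : Fin d → ℝ) : 0 ≤ detRiskLoc σ Q sel μ :=
  integral_nonneg fun _ => Nat.cast_nonneg _

/-- Theorem 11 of the paper: sufficient conditions for exact recovery (in
expected Hamming risk and in probability of wrong recovery) and for almost full recovery by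
thresholding selectors in the light-tail location model. -/
theorem statement17 (ν σ : ℝ) (hν : 1 ≤ ν) (hσ : 0 < σ)
    (s : ℕ → ℕ) (a : ℕ → ℝ)
    (hs : ∀ᶠ d in atTop, 1 ≤ s d ∧ s d < d) :
    ((Tendsto (fun d : ℕ => (d : ℝ) - s d) atTop atTop) →
      (∀ᶠ d : ℕ in atTop,
        σ * ((ν * Real.log ((d : ℝ) - s d)
              + ν * Real.log (Real.log ((d : ℝ) - s d))) ^ (1 / ν)
          + (ν * Real.log (s d : ℝ)
              + ν * Real.log (Real.log ((d : ℝ) - s d))) ^ (1 / ν)) ≤ a d) →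
      Tendsto (fun d : ℕ => ⨆ Q : Pclass ν, ⨆ μ : ThetaLoc d (s d) (a d),
          detRiskLoc σ Q.1 (threshLoc σ ν ((d : ℝ) - s d)) μ.1) atTop (nhds 0)
      ∧ Tendsto (fun d : ℕ => ⨆ Q : Pclass ν, ⨆ μ : ThetaLoc d (s d) (a d),
          ((Ploc σ Q.1 μ.1)
            {X | threshLoc σ ν ((d : ℝ) - s d) X ≠ etaOf μ.1}).toReal) atTop (nhds 0))
    ∧ ((Tendsto (fun d : ℕ => (d : ℝ) / s d) atTop atTop) →
      (∀ᶠ d : ℕ in atTop,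
        σ * ((ν * Real.log ((d : ℝ) / s d - 1)
              + ν * Real.log (Real.log ((d : ℝ) / s d - 1))) ^ (1 / ν)
          + (ν * Real.log (Real.log ((d : ℝ) / s d - 1))) ^ (1 / ν)) ≤ a d) →
      Tendsto (fun d : ℕ => (s d : ℝ)⁻¹ * ⨆ Q : Pclass ν, ⨆ μ : ThetaLoc d (s d) (a d),
          detRiskLoc σ Q.1 (threshLoc σ ν ((d : ℝ) / s d - 1)) μ.1) atTop (nhds 0)) := by
  refine ⟨fun hx ha => ?_, fun hx ha => ?_⟩
  · have hlim : Tendsto (fun d : ℕ => 2 / Real.log ((d : ℝ) - s d)) atTop (nhds 0) :=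
      (Real.tendsto_log_atTop.comp hx).const_div_atTop 2
    have hrisk : ∀ᶠ d : ℕ in atTop, 0 ≤ 2 / Real.log ((d : ℝ) - s d) ∧
        ∀ Q ∈ Pclass ν, ∀ μ ∈ ThetaLoc d (s d) (a d),
          detRiskLoc σ Q (threshLoc σ ν ((d : ℝ) - s d)) μ ≤ 2 / Real.log ((d : ℝ) - s d) := by
      filter_upwards [hs, ha, hx.eventually_gt_atTop (Real.exp 1)] with d hsd had hxd
      have hx0 : 0 < (d : ℝ) - s d := (Real.exp_pos 1).trans hxd
      have hlog : 1 < Real.log ((d : ℝ) - s d) := (Real.lt_log_iff_exp_lt hx0).2 hxd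
      have hs1 : (1 : ℝ) ≤ s d := by exact_mod_cast hsd.1
      refine ⟨by positivity, fun Q hQ μ hμ => ?_⟩
      refine (detRiskLoc_threshLoc_le_div hν hσ hxd hs1 hsd.2.le had hQ hμ).trans_eq ?_
      field_simp
      norm_num
    constructor
    · refine tendsto_of_tendsto_of_tendsto_of_le_of_le' tendsto_const_nhds hlim
        (Eventually.of_forall fun d => Real.iSup_nonneg fun Q => Real.iSup_nonneg fun μ =>
          detRiskLoc_nonneg _ _ _ _) ?_
      filter_upwards [hrisk] with d hd
      exact iSup_Pclass_ThetaLoc_le hd.1 hd.2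
    · refine tendsto_of_tendsto_of_tendsto_of_le_of_le' tendsto_const_nhds hlim
        (Eventually.of_forall fun d => Real.iSup_nonneg fun Q => Real.iSup_nonneg fun μ =>
          ENNReal.toReal_nonneg) ?_
      filter_upwards [hrisk] with d hd
      refine iSup_Pclass_ThetaLoc_le (f := fun Q μ => ((Ploc σ Q μ)
        {X | threshLoc σ ν ((d : ℝ) - s d) X ≠ etaOf μ}).toReal) hd.1 fun Q hQ μ hμ => ?_
      have := hQ.1
      exact (Ploc_threshLoc_ne_le_detRiskLoc σ ν _ μ).trans (hd.2 Q hQ μ hμ)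
  · have hx' : Tendsto (fun d : ℕ => (d : ℝ) / s d - 1) atTop atTop :=
      tendsto_atTop_add_const_right _ (-1) hx
    have hlim : Tendsto (fun d : ℕ => 2 / Real.log ((d : ℝ) / s d - 1)) atTop (nhds 0) :=
      (Real.tendsto_log_atTop.comp hx').const_div_atTop 2
    refine tendsto_of_tendsto_of_tendsto_of_le_of_le' tendsto_const_nhds hlim
      (Eventually.of_forall fun d => mul_nonneg (by positivity) (Real.iSup_nonneg fun Q =>
        Real.iSup_nonneg fun μ => detRiskLoc_nonneg _ _ _ _)) ?_
    filter_upwards [hs, ha, hx'.eventually_gt_atTop (Real.exp 1)] with d hsd had hxd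
    have hx0 : 0 < (d : ℝ) / s d - 1 := (Real.exp_pos 1).trans hxd
    have hlog : 1 < Real.log ((d : ℝ) / s d - 1) := (Real.lt_log_iff_exp_lt hx0).2 hxd
    have hs0 : (0 : ℝ) < s d := by exact_mod_cast hsd.1
    rw [inv_mul_le_iff₀ hs0]
    refine iSup_Pclass_ThetaLoc_le (f := fun Q μ => detRiskLoc σ Q
      (threshLoc σ ν ((d : ℝ) / s d - 1)) μ) (by positivity) fun Q hQ μ hμ => ?_
    refine (detRiskLoc_threshLoc_le_div hν hσ hxd le_rfl hsd.2.le (by simpa using had)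
      hQ hμ).trans_eq ?_
    have hds : (d : ℝ) - s d = s d * ((d : ℝ) / s d - 1) := by field_simp
    rw [hds]
    generalize (d : ℝ) / s d - 1 = x at hx0 hlog ⊢
    field_simp
    norm_num

end
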